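/- Merzlyakov's Theorem: Let k ≥ 2 and let F_k be the free group on k generators. Let X and Y be finite sets and let Σ be a finite subset of the free group F(X ⊔ Y) on the disjoint union X ⊔ Y (a finite system of equations Σ(x,y) = 1 without coefficients). Suppose F_k satisfies the sentence ∀y ∃x Σ(x,y) = 1, i.e. for every map σ : Y → F_k there exists a map τ : X → F_k such that every word w ∈ Σ is sent to the identity by the homomorphism F(X ⊔ Y) → F_k induced by τ on X and σ on Y. Then there exists a retraction π : G_Σ → F(Y), i.e. a group homomorphism from the presented group G_Σ = ⟨X ⊔ Y | Σ⟩ to the free group F(Y) which sends the generator of G_Σ corresponding to each y ∈ Y to the basis element y of F(Y). -/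

import Mathlib

open Monoid (CoprodI)

section SyllableProduct

variable {ι : Type*} {G : ι → Type*} [∀ i, Group (G i)] {K : Type*} [Group K]

/-- The syllable lists that are reduced, i.e. the underlying lists of `Monoid.CoprodI.Word`s. -/
def IsReducedSyllables (l : List (Σ i, G i)) : Prop :=
  (∀ p ∈ l, p.2 ≠ 1) ∧ l.IsChain fun p q => p.1 ≠ q.1

/-- The element of the free product spelled by a list of syllables. -/
def syllablesProd (l : List (Σ i, G i)) : CoprodI G :=
  (l.map fun p => CoprodI.of p.2).prod

open Classical in
/-- Given a function `f` on syllables, multiply the values of `f` along the normal form of an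
element of a free product. If `f` is odd then this is a quasi-homomorphism in the sense of Rolli. -/
noncomputable def rolli (f : (Σ i, G i) → K) (g : CoprodI G) : K :=
  ((CoprodI.Word.equiv g).toList.map f).prod

theorem rolli_syllablesProd (f : (Σ i, G i) → K) {l : List (Σ i, G i)}
    (hl : IsReducedSyllables l) : rolli f (syllablesProd l) = (l.map f).prod := by
  classical
  let w : CoprodI.Word G := ⟨l, hl.1, hl.2⟩
  have hw : CoprodI.Word.equiv w.prod = w := CoprodI.Word.equiv.apply_symm_apply w
  have : syllablesProd l = w.prod := rfl
  rw [rolli, this]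
  convert rfl
  exact (congrArg CoprodI.Word.toList hw).symm

theorem exists_syllablesProd_eq (g : CoprodI G) :
    ∃ l, IsReducedSyllables l ∧ syllablesProd l = g := by
  classical
  let w := CoprodI.Word.equiv g
  exact ⟨w.toList, ⟨w.ne_one, w.chain_ne⟩, CoprodI.Word.equiv.symm_apply_apply g⟩

theorem rolli_one (f : (Σ i, G i) → K) : rolli f 1 = 1 :=
  rolli_syllablesProd (l := []) f ⟨by simp, by simp⟩

theorem exists_finset_rolli_syllablesProd_mul (l₁ l₂ : List (Σ i, G i))
    (h₁ : IsReducedSyllables l₁) (h₂ : IsReducedSyllables l₂) :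
    ∃ B : Finset (Σ i, G i), B.card ≤ 3 ∧ ∀ f : (Σ i, G i) → K,
      (∀ i (x : G i), f ⟨i, x⁻¹⟩ = (f ⟨i, x⟩)⁻¹) → (∀ p ∈ B, f p = 1) →
        rolli f (syllablesProd l₁ * syllablesProd l₂) = (l₁.map f).prod * (l₂.map f).prod := by
  classical
  induction l₁ using List.reverseRecOn generalizing l₂ with
  | nil =>
    refine ⟨∅, by simp, fun f _ _ => ?_⟩
    simpa [syllablesProd] using rolli_syllablesProd f h₂
  | append_singleton l₁ p ih =>
    cases l₂ with
    | nil =>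
      refine ⟨∅, by simp, fun f _ _ => ?_⟩
      simpa [syllablesProd] using rolli_syllablesProd f h₁
    | cons q l₂ =>
      obtain ⟨i, x⟩ := p
      obtain ⟨j, y⟩ := q
      obtain ⟨hn₁, hc₁⟩ := h₁
      obtain ⟨hn₂, hc₂⟩ := h₂
      by_cases hij : i = j
      · subst hij
        have hr₁ : IsReducedSyllables l₁ :=
          ⟨fun p hp => hn₁ p (by simp [hp]), (List.isChain_append.1 hc₁).1⟩
        have hr₂ : IsReducedSyllables l₂ :=
          ⟨fun p hp => hn₂ p (by simp [hp]), (List.isChain_cons.1 hc₂).2⟩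
        by_cases hxy : x * y = 1
        · obtain ⟨B, hB, H⟩ := ih l₂ hr₁ hr₂
          refine ⟨B, hB, fun f hf hfB => ?_⟩
          obtain rfl : y = x⁻¹ := (inv_eq_of_mul_eq_one_right hxy).symm
          simpa [syllablesProd, hf, mul_assoc] using H f hf hfB
        · refine ⟨{⟨i, x⟩, ⟨i, y⟩, ⟨i, x * y⟩}, Finset.card_le_three, fun f _ hfB => ?_⟩
          have hr : IsReducedSyllables (l₁ ++ ⟨i, x * y⟩ :: l₂) := by
            refine ⟨?_, ?_⟩
            · intro p hp
              rw [List.mem_append, List.mem_cons] at hp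
              rcases hp with hp | rfl | hp
              exacts [hr₁.1 p hp, hxy, hr₂.1 p hp]
            · rw [List.isChain_append, List.isChain_cons] at hc₁ ⊢
              rw [List.isChain_cons] at hc₂
              exact ⟨hc₁.1, hc₂, by simpa using hc₁.2.2⟩
          have := rolli_syllablesProd f hr
          simp only [Finset.mem_insert, Finset.mem_singleton, forall_eq_or_imp, forall_eq] at hfB
          simpa [syllablesProd, hfB, mul_assoc] using this
      · refine ⟨∅, by simp, fun f _ _ => ?_⟩
        have hr : IsReducedSyllables ((l₁ ++ [⟨i, x⟩]) ++ ⟨j, y⟩ :: l₂) := by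
          refine ⟨?_, ?_⟩
          · intro p hp
            rcases List.mem_append.1 hp with hp | hp
            exacts [hn₁ p hp, hn₂ p hp]
          · rw [List.isChain_append]
            exact ⟨hc₁, hc₂, by simpa using hij⟩
        simpa [syllablesProd, mul_assoc] using rolli_syllablesProd f hr

theorem exists_finset_rolli_mul (g h : CoprodI G) :
    ∃ B : Finset (Σ i, G i), B.card ≤ 3 ∧ ∀ f : (Σ i, G i) → K,
      (∀ i (x : G i), f ⟨i, x⁻¹⟩ = (f ⟨i, x⟩)⁻¹) → (∀ p ∈ B, f p = 1) →
        rolli f (g * h) = rolli f g * rolli f h := by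
  obtain ⟨l₁, h₁, rfl⟩ := exists_syllablesProd_eq g
  obtain ⟨l₂, h₂, rfl⟩ := exists_syllablesProd_eq h
  obtain ⟨B, hB, H⟩ := exists_finset_rolli_syllablesProd_mul (K := K) l₁ l₂ h₁ h₂
  refine ⟨B, hB, fun f hf hfB => ?_⟩
  rw [H f hf hfB, rolli_syllablesProd f h₁, rolli_syllablesProd f h₂]

/-- The number of syllables one has to kill in order that `rolli f` evaluates a word `w`
multiplicatively is bounded in terms of `w` only. -/
theorem exists_bound_rolli_freeGroup {Z : Type*} (w : FreeGroup Z) :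
    ∃ N : ℕ, ∀ φ : FreeGroup Z →* CoprodI G, ∃ B : Finset (Σ i, G i), B.card ≤ N ∧
      ∀ f : (Σ i, G i) → K, (∀ i (x : G i), f ⟨i, x⁻¹⟩ = (f ⟨i, x⟩)⁻¹) → (∀ p ∈ B, f p = 1) →
        FreeGroup.lift (fun z => rolli f (φ (.of z))) w = rolli f (φ w) := by
  classical
  induction w with
  | C1 => exact ⟨0, fun φ => ⟨∅, le_rfl, fun f _ _ => by simp [rolli_one]⟩⟩
  | of z => exact ⟨0, fun φ => ⟨∅, le_rfl, fun f _ _ => by simp⟩⟩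
  | inv_of z _ =>
    refine ⟨3, fun φ => ?_⟩
    obtain ⟨B, hB, H⟩ := exists_finset_rolli_mul (K := K) (φ (.of z)) (φ (.of z))⁻¹
    refine ⟨B, hB, fun f hf hfB => ?_⟩
    have := H f hf hfB
    rw [mul_inv_cancel, rolli_one] at this
    simpa using inv_eq_of_mul_eq_one_right this.symm
  | mul u v hu hv =>
    obtain ⟨Nu, hu⟩ := hu
    obtain ⟨Nv, hv⟩ := hv
    refine ⟨Nu + Nv + 3, fun φ => ?_⟩
    obtain ⟨Bu, hBu, Hu⟩ := hu φ
    obtain ⟨Bv, hBv, Hv⟩ := hv φ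
    obtain ⟨B, hB, H⟩ := exists_finset_rolli_mul (K := K) (φ u) (φ v)
    refine ⟨Bu ∪ Bv ∪ B, ?_, fun f hf hfB => ?_⟩
    · have h₁ := Finset.card_union_le (Bu ∪ Bv) B
      have h₂ := Finset.card_union_le Bu Bv
      omega
    · rw [map_mul, map_mul, H f hf fun p hp => hfB p (by simp [hp]),
        Hu f hf fun p hp => hfB p (by simp [hp]), Hv f hf fun p hp => hfB p (by simp [hp])]

theorem exists_bound_rolli_of_finite {Z : Type*} {S : Set (FreeGroup Z)} (hS : S.Finite) :
    ∃ N : ℕ, ∀ φ : FreeGroup Z →* CoprodI G, ∃ B : Finset (Σ i, G i), B.card ≤ N ∧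
      ∀ f : (Σ i, G i) → K, (∀ i (x : G i), f ⟨i, x⁻¹⟩ = (f ⟨i, x⟩)⁻¹) → (∀ p ∈ B, f p = 1) →
        ∀ w ∈ S, FreeGroup.lift (fun z => rolli f (φ (.of z))) w = rolli f (φ w) := by
  classical
  induction S, hS using Set.Finite.induction_on with
  | empty => exact ⟨0, fun φ => ⟨∅, le_rfl, by simp⟩⟩
  | @insert w S _ _ ih =>
    obtain ⟨N, ih⟩ := ih
    obtain ⟨M, hw⟩ := exists_bound_rolli_freeGroup (G := G) (K := K) w
    refine ⟨M + N, fun φ => ?_⟩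
    obtain ⟨B, hB, H⟩ := ih φ
    obtain ⟨C, hC, H'⟩ := hw φ
    refine ⟨C ∪ B, (Finset.card_union_le C B).trans (by omega), fun f hf hfB => ?_⟩
    rintro v (rfl | hv)
    · exact H' f hf fun p hp => hfB p (by simp [hp])
    · exact H f hf (fun p hp => hfB p (by simp [hp])) v hv

end SyllableProduct

section MarkerWord

/-- The syllables of `a b ^ n₁ a b ^ n₂ ⋯` in the free product of two infinite cyclic groups
`⟨a⟩` (index `false`) and `⟨b⟩` (index `true`). -/
def markerSyllables (l : List ℕ) : List (Σ _ : Bool, Multiplicative ℤ) :=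
  l.flatMap fun n : ℕ => [⟨false, .ofAdd 1⟩, ⟨true, .ofAdd (n : ℤ)⟩]

theorem isReducedSyllables_markerSyllables {l : List ℕ} (hl : ∀ n ∈ l, n ≠ 0) :
    IsReducedSyllables (G := fun _ : Bool => Multiplicative ℤ) (markerSyllables l) := by
  induction l with
  | nil => exact ⟨by simp [markerSyllables], by simp [markerSyllables]⟩
  | cons n l ih =>
    obtain ⟨h₁, h₂⟩ := ih fun m hm => hl m (by simp [hm])
    have hn : n ≠ 0 := hl n (by simp)
    have : markerSyllables (n :: l) =
      ⟨false, .ofAdd 1⟩ :: ⟨true, .ofAdd (n : ℤ)⟩ :: markerSyllables l := rfl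
    rw [this]
    refine ⟨?_, ?_⟩
    · intro p hp
      rw [List.mem_cons, List.mem_cons] at hp
      rcases hp with rfl | rfl | hp
      · simp
      · simpa using hn
      · exact h₁ p hp
    · rw [List.isChain_cons, List.isChain_cons]
      refine ⟨by simp, ?_, h₂⟩
      cases l <;> simp [markerSyllables]

end MarkerWord

/-- **Merzlyakov's Theorem.** Let `F_k` be the free group on `k ≥ 2` generators, `X`, `Y`
finite sets and `S` a finite system of (coefficient-free) equations, i.e. a finite subset of
the free group on `X ⊕ Y`.  If `F_k ⊨ ∀ y ∃ x Σ(x,y) = 1`, i.e. every assignment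
`σ : Y → F_k` extends by some `τ : X → F_k` to a map killing every word of `S`, then there is
a retraction `π : G_Σ = ⟨X ⊕ Y ∣ S⟩ → F(Y)` sending the generator corresponding to each
`y ∈ Y` to the basis element `y` of `F(Y)`. -/
theorem merzlyakov (k : ℕ) (hk : 2 ≤ k) (X Y : Type) [Finite X] [Finite Y]
    (S : Set (FreeGroup (X ⊕ Y))) (hS : S.Finite)
    (h : ∀ σ : Y → FreeGroup (Fin k), ∃ τ : X → FreeGroup (Fin k),
      ∀ w ∈ S, FreeGroup.lift (Sum.elim τ σ) w = 1) :
    ∃ π : PresentedGroup S →* FreeGroup Y,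
      ∀ y : Y, π (PresentedGroup.of (Sum.inr y)) = FreeGroup.of y := by
  classical
  let G : Bool → Type := fun _ => Multiplicative ℤ
  obtain ⟨N, hN⟩ := exists_bound_rolli_of_finite (G := G) (K := FreeGroup Y) hS
  obtain ⟨e, he⟩ := exists_injective_nat (Y × Fin (N + 1))
  let exps (y : Y) : List ℕ := (List.finRange (N + 1)).map fun i => e (y, i) + 1
  let gen (i : Bool) : FreeGroup (Fin k) := .of (if i then ⟨1, by omega⟩ else ⟨0, by omega⟩)
  let ρ : FreeGroup (Fin k) →* CoprodI G := FreeGroup.lift fun i =>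
    CoprodI.of (M := G) (i := i.1 == 1) (.ofAdd 1)
  have hρ (l : List (Σ i, G i)) :
      ρ (l.map fun p => gen p.1 ^ p.2.toAdd).prod = syllablesProd l := by
    rw [map_list_prod, List.map_map, syllablesProd]
    congr 2
    funext ⟨i, x⟩
    have : ρ (gen i) = CoprodI.of (M := G) (i := i) (.ofAdd 1) := by
      cases i <;> simp [ρ, gen]
    simp only [Function.comp_apply, map_zpow, this]
    rw [← map_zpow, ← ofAdd_zsmul]
    simp
  obtain ⟨τ, hτ⟩ := h fun y => ((markerSyllables (exps y)).map fun p => gen p.1 ^ p.2.toAdd).prod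
  let φ := ρ.comp (FreeGroup.lift (Sum.elim τ fun y =>
    ((markerSyllables (exps y)).map fun p => gen p.1 ^ p.2.toAdd).prod))
  obtain ⟨B, hB, H⟩ := hN φ
  have hs (y : Y) : ∃ i, e (y, i) + 1 ∉ B.image fun p => Int.natAbs p.2.toAdd := by
    by_contra! hcon
    have hinj : Function.Injective fun i => e (y, i) + 1 := fun i j hij => by
      simpa using he (Nat.succ_injective hij)
    have := Finset.card_le_card_of_injOn (s := Finset.univ) _ (fun i _ => hcon i) hinj.injOn
    have := this.trans Finset.card_image_le
    rw [Finset.card_univ, Fintype.card_fin] at this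
    omega
  choose s hs using hs
  have hinj : Function.Injective fun y => e (y, s y) + 1 := fun y z hyz =>
    congrArg Prod.fst (he (Nat.succ_injective hyz))
  let c : ℕ → FreeGroup Y := Function.extend (fun y => e (y, s y) + 1) FreeGroup.of 1
  let f : (Σ i, G i) → FreeGroup Y := fun p =>
    if p.1 then c p.2.toAdd.natAbs ^ p.2.toAdd.sign else 1
  have hf (i) (x : G i) : f ⟨i, x⁻¹⟩ = (f ⟨i, x⟩)⁻¹ := by
    cases i
    · simp [f]
    · have : x⁻¹.toAdd = -x.toAdd := rfl
      simp [f, this]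
  have hfB (p) (hp : p ∈ B) : f p = 1 := by
    have : c p.2.toAdd.natAbs = 1 :=
      Function.extend_apply' _ _ _ fun ⟨y, hy⟩ => hs y (Finset.mem_image.2 ⟨p, hp, hy.symm⟩)
    simp [f, this]
  have hfm (l : List ℕ) (hl : ∀ n ∈ l, n ≠ 0) :
      ((markerSyllables l).map f).prod = (l.map c).prod := by
    induction l with
    | nil => rfl
    | cons n l ih =>
      have hn : n ≠ 0 := hl n (by simp)
      have := ih fun m hm => hl m (by simp [hm])
      simp only [markerSyllables] at this
      simp [markerSyllables, f, this, Int.sign_natCast_of_ne_zero hn]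
  refine ⟨PresentedGroup.toGroup (f := fun z => rolli f (φ (.of z))) fun w hw => ?_, fun y => ?_⟩
  · rw [H f hf hfB w hw]
    simp [φ, hτ w hw, rolli_one]
  · have hpos : ∀ n ∈ exps y, n ≠ 0 := by simp [exps]
    have hφ : φ (.of (.inr y)) = syllablesProd (markerSyllables (exps y)) := by
      simp only [φ, MonoidHom.comp_apply, FreeGroup.lift_apply_of, Sum.elim_inr]
      exact hρ _
    rw [PresentedGroup.toGroup.of, hφ,
      rolli_syllablesProd f (isReducedSyllables_markerSyllables hpos), hfm _ hpos, List.map_map]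
    have hc : c ∘ (fun i => e (y, i) + 1) = fun i => if i = s y then FreeGroup.of y else 1 := by
      funext i
      split_ifs with hi
      · subst hi
        exact hinj.extend_apply _ _ y
      · refine Function.extend_apply' _ _ _ fun ⟨z, hz⟩ => hi ?_
        have := he (Nat.succ_injective hz)
        grind
    rw [hc, List.prod_map_eq_pow_single (s y) _ fun i hi _ => if_neg hi,
      List.count_eq_one_of_mem (List.nodup_finRange _) (List.mem_finRange _)]
    simp
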